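/- Let T = (AddCircle (1:ℝ)) × (AddCircle (1:ℝ)) be the 2-dimensional torus, let S ⊆ T be a finite set of cardinality m with m ≥ 1, let X = T \ S (with the subspace topology), let k ≥ 1, and let F_k(X) = {f : Fin k → X // Function.Injective f} be the ordered configuration space of k points in X (with the subspace topology induced from the product topology on Fin k → X). Then for every basepoint y ∈ F_k(X), the second homotopy group π₂(F_k(X), y) is trivial, i.e., HomotopyGroup 2 (F_k(X)) y is a subsingleton. -/

import Mathlib

open unitInterval Topology Set

namespace PuncturedTorus

section Spheres

variable {X Y Z : Type*} [TopologicalSpace X] [TopologicalSpace Y] [TopologicalSpace Z]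

/-- A map from the square into `U` that is constant on the boundary of the square. -/
def IsSphereIn (U : Set Y) (f : C(Fin 2 → I, Y)) : Prop :=
  (∀ u, f u ∈ U) ∧ ∀ u ∈ Cube.boundary (Fin 2), ∀ v ∈ Cube.boundary (Fin 2), f u = f v

/-- Every 2-sphere in `U` is freely null-homotopic in `U`. -/
def SphereNull (U : Set Y) : Prop :=
  ∀ f : C(Fin 2 → I, Y), IsSphereIn U f →
    ∃ c, f.HomotopicWith (ContinuousMap.const _ c) (IsSphereIn U)

theorem homotopicWith_of_continuous {P : C(X, Y) → Prop} {f g : C(X, Y)} (H : I × X → Y)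
    (hH : Continuous H) (h₀ : ∀ x, H (0, x) = f x) (h₁ : ∀ x, H (1, x) = g x)
    (hP : ∀ t, P ⟨fun x => H (t, x), by fun_prop⟩) : f.HomotopicWith g P :=
  ⟨⟨⟨⟨H, hH⟩, h₀, h₁⟩, hP⟩⟩

/-- Spheres that come from spheres of a set `V` all of whose spheres are null-homotopic. -/
theorem exists_homotopicWith_const_of_comp {U : Set Y} {V : Set Z} (hV : SphereNull V)
    {ψ : Z → Y} (hψ : Continuous ψ) (hVU : MapsTo ψ V U) {f : C(Fin 2 → I, Y)}
    {g : C(Fin 2 → I, Z)} (hg : IsSphereIn V g) (hfg : ∀ u, ψ (g u) = f u) :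
    ∃ c, f.HomotopicWith (ContinuousMap.const _ c) (IsSphereIn U) := by
  obtain ⟨c, ⟨F⟩⟩ := hV g hg
  refine ⟨ψ c, homotopicWith_of_continuous (fun x => ψ (F x)) (by fun_prop) ?_ ?_ fun t => ?_⟩
  · simp [hfg]
  · simp
  · exact ⟨fun u => hVU ((F.prop t).1 u), fun u hu v hv => congrArg ψ ((F.prop t).2 u hu v hv)⟩

/-- The property is invariant under homeomorphisms. -/
theorem SphereNull.preimage {U : Set Y} (e : Y ≃ₜ Z) (h : SphereNull (e.symm ⁻¹' U)) :
    SphereNull U := fun f hf =>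
  exists_homotopicWith_const_of_comp h e.symm.continuous (fun _ hx => hx)
    (g := ⟨fun u => e (f u), by fun_prop⟩)
    ⟨fun u => by simpa using hf.1 u, fun u hu v hv => congrArg e (hf.2 u hu v hv)⟩ (by simp)

/-- A map of the square stretching the square, sending a collar to the boundary. -/
noncomputable def stretch (s : I) (u : Fin 2 → I) : Fin 2 → I :=
  fun i => projIcc 0 1 zero_le_one ((u i : ℝ) + s * ((u i : ℝ) - 1 / 2))

/-- A function vanishing on the boundary of the square and equal to `1` off a collar. -/
noncomputable def collar (u : Fin 2 → I) : I :=
  projIcc 0 1 zero_le_one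
    (4 * min (min (u 0 : ℝ) (1 - u 0)) (min (u 1 : ℝ) (1 - u 1)))

theorem continuous_stretch : Continuous fun x : I × (Fin 2 → I) => stretch x.1 x.2 := by
  unfold stretch
  refine continuous_pi fun i => continuous_projIcc.comp ?_
  fun_prop

theorem continuous_collar : Continuous collar := by
  unfold collar
  refine continuous_projIcc.comp ?_
  fun_prop

theorem stretch_zero (u : Fin 2 → I) : stretch 0 u = u := by
  funext i
  simp [stretch]

theorem stretch_mem_boundary (s : I) {u : Fin 2 → I} (hu : u ∈ Cube.boundary (Fin 2)) :
    stretch s u ∈ Cube.boundary (Fin 2) := by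
  obtain ⟨i, hi⟩ := hu
  have hs := s.2.1
  refine ⟨i, hi.imp (fun h => ?_) fun h => ?_⟩
  · exact projIcc_of_le_left _ (by rw [h]; norm_num; linarith)
  · exact projIcc_of_right_le _ (by rw [h]; norm_num; linarith)

theorem collar_boundary {u : Fin 2 → I} (hu : u ∈ Cube.boundary (Fin 2)) : collar u = 0 := by
  obtain ⟨i, hi⟩ := hu
  refine projIcc_of_le_left _ ?_
  have : min (min (u 0 : ℝ) (1 - u 0)) (min (u 1 : ℝ) (1 - u 1)) ≤ 0 := by
    fin_cases i <;> rcases hi with h | h <;> simp_all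
  linarith

theorem collar_eq_one_or (u : Fin 2 → I) :
    collar u = 1 ∨ stretch 1 u ∈ Cube.boundary (Fin 2) := by
  by_cases h : 1 / 4 ≤ min (min (u 0 : ℝ) (1 - u 0)) (min (u 1 : ℝ) (1 - u 1))
  · exact Or.inl (projIcc_of_right_le _ (by linarith))
  · right
    simp only [le_min_iff, not_and_or, not_le] at h
    have key : ∀ i, (u i : ℝ) < 1 / 4 ∨ 1 - (u i : ℝ) < 1 / 4 →
        stretch 1 u ∈ Cube.boundary (Fin 2) := fun i hi =>
      ⟨i, hi.imp (fun h => projIcc_of_le_left _ (by norm_num; linarith))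
        fun h => projIcc_of_right_le _ (by norm_num; linarith)⟩
    exact h.elim (key 0) (key 1)

/-- A free null-homotopy can be turned into one that is constant on the boundary. -/
theorem SphereNull.exists_rel {U : Set Y} (hU : SphereNull U) {f : C(Fin 2 → I, Y)} {c : Y}
    (hf : ∀ u, f u ∈ U) (hc : ∀ u ∈ Cube.boundary (Fin 2), f u = c) :
    f.HomotopicWith (ContinuousMap.const _ c)
      fun g => (∀ u, g u ∈ U) ∧ ∀ u ∈ Cube.boundary (Fin 2), g u = c := by
  obtain ⟨d, ⟨F⟩⟩ := hU f ⟨hf, fun u hu v hv => (hc u hu).trans (hc v hv).symm⟩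
  have hFU : ∀ t u, F (t, u) ∈ U := fun t => (F.prop t).1
  have hF₂ : ∀ t, ∀ u ∈ Cube.boundary (Fin 2), ∀ v ∈ Cube.boundary (Fin 2),
    F (t, u) = F (t, v) := fun t => (F.prop t).2
  have h0 : (0 : Fin 2 → I) ∈ Cube.boundary (Fin 2) := ⟨0, Or.inl rfl⟩
  have c₁ := continuous_stretch
  have c₂ := continuous_collar
  let f₁ : C(Fin 2 → I, Y) := ⟨fun u => f (stretch 1 u), by fun_prop⟩
  let f₂ : C(Fin 2 → I, Y) := ⟨fun u => F (collar u, stretch 1 u), by fun_prop⟩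
  have e₁ : f.HomotopicWith f₁
      fun g => (∀ u, g u ∈ U) ∧ ∀ u ∈ Cube.boundary (Fin 2), g u = c :=
    homotopicWith_of_continuous (fun x => f (stretch x.1 x.2)) (by fun_prop)
      (fun u => by simp [stretch_zero]) (fun u => rfl)
      fun t => ⟨fun u => hf _, fun u hu => hc _ (stretch_mem_boundary t hu)⟩
  have e₂ : f₁.HomotopicWith f₂
      fun g => (∀ u, g u ∈ U) ∧ ∀ u ∈ Cube.boundary (Fin 2), g u = c := by
    refine homotopicWith_of_continuous (fun x => F (min x.1 (collar x.2), stretch 1 x.2))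
      (by fun_prop) (fun u => ?_) (fun u => ?_) fun t => ⟨fun u => hFU _ _, fun u hu => ?_⟩
    · simp [f₁]
    · simp [f₂, min_eq_right (le_one' : collar u ≤ 1)]
    · simp [collar_boundary hu, hc _ (stretch_mem_boundary 1 hu)]
  have e₃ : f₂.HomotopicWith (ContinuousMap.const _ c)
      fun g => (∀ u, g u ∈ U) ∧ ∀ u ∈ Cube.boundary (Fin 2), g u = c := by
    refine homotopicWith_of_continuous (fun x => F (σ x.1 * collar x.2, 0))
      (by fun_prop) (fun u => ?_) (fun u => ?_) fun t => ⟨fun u => hFU _ _, fun u hu => ?_⟩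
    · rcases collar_eq_one_or u with h | h
      · simp [f₂, h]
      · simpa [f₂] using hF₂ _ _ h0 _ h
    · simp [hc _ h0]
    · simp [collar_boundary hu, hc _ h0]
  exact (e₁.trans e₂).trans e₃

theorem subsingleton_homotopyGroup {ι : X → Y} (hι : IsEmbedding ι)
    (h : SphereNull (range ι)) (x : X) : Subsingleton (HomotopyGroup (Fin 2) X x) := by
  have key : ∀ f : GenLoop (Fin 2) X x, GenLoop.Homotopic f GenLoop.const := by
    intro f
    obtain ⟨F⟩ := h.exists_rel (f := ⟨fun u => ι (f u), hι.continuous.comp f.1.continuous⟩)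
      (c := ι x) (fun u => mem_range_self _) (fun u hu => congrArg ι (f.2 u hu))
    have hF : ∀ p, ∃ z, ι z = F p := fun p => (F.prop p.1).1 p.2
    choose G hG using hF
    have hGc : Continuous G := by
      rw [hι.continuous_iff]
      simpa only [Function.comp_def, hG] using F.continuous
    refine ⟨⟨⟨⟨G, hGc⟩, fun u => hι.injective ?_, fun u => hι.injective ?_⟩,
      fun t u hu => hι.injective ?_⟩⟩
    · exact (hG _).trans (F.apply_zero u)
    · exact (hG _).trans (F.apply_one u)
    · refine (hG _).trans (((F.prop t).2 u hu).trans ?_)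
      exact congrArg ι (f.2 u hu).symm
  refine ⟨fun a b => ?_⟩
  induction a using Quotient.inductionOn
  induction b using Quotient.inductionOn
  exact Quotient.sound ((key _).trans (key _).symm)

end Spheres

section Lifting

variable {E X : Type*} [TopologicalSpace E] [TopologicalSpace X] {p : E → X}

theorem isPreconnected_boundary : IsPreconnected (Cube.boundary (Fin 2)) := by
  have hface : ∀ (i : Fin 2) (c : I), IsPreconnected {u : Fin 2 → I | u i = c} := by
    intro i c
    have : {u : Fin 2 → I | u i = c} = range fun t : Fin 2 → I => Function.update t i c := by
      ext u
      refine ⟨fun h => ⟨u, Function.update_eq_self_iff.2 (h : u i = c).symm⟩, ?_⟩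
      rintro ⟨t, rfl⟩
      simp
    rw [this]
    exact isPreconnected_range (by fun_prop)
  have heq : Cube.boundary (Fin 2) =
      ({u | u 0 = 0} ∪ {u | u 1 = 0}) ∪ ({u | u 0 = 1} ∪ {u | u 1 = 1}) := by
    ext u
    simp only [Cube.boundary, mem_ofPred_eq, Fin.exists_fin_two, mem_union]
    tauto
  rw [heq]
  refine IsPreconnected.union ![0, 1] ?_ ?_ ?_ ?_
  · simp
  · simp
  · exact IsPreconnected.union ![0, 0] rfl rfl (hface _ _) (hface _ _)
  · exact IsPreconnected.union ![1, 1] rfl rfl (hface _ _) (hface _ _)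

theorem exists_lift_square (cov : IsCoveringMap p) (f : C(Fin 2 → I, X)) (e : E)
    (he : p e = f 0) : ∃ g : C(Fin 2 → I, E), g 0 = e ∧ ∀ u, p (g u) = f u := by
  let r : (Fin 2 → ℝ) → Fin 2 → I := fun v i => projIcc 0 1 zero_le_one (v i)
  have hr : Continuous r := continuous_pi fun i => continuous_projIcc.comp (by fun_prop)
  have hr' : ∀ u : Fin 2 → I, r (fun i => u i) = u := fun u => by funext i; simp [r]
  obtain ⟨F, ⟨hF₀, hF⟩, -⟩ := cov.existsUnique_continuousMap_lifts (f.comp ⟨r, hr⟩)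
    (fun i => ((0 : Fin 2 → I) i : ℝ)) e (he.trans (congrArg f (hr' 0).symm))
  refine ⟨⟨fun u => F fun i => u i, by fun_prop⟩, hF₀, fun u => ?_⟩
  simpa [hr'] using congrFun hF (fun i => (u i : ℝ))

theorem lift_const_boundary (cov : IsCoveringMap p) {f : C(Fin 2 → I, X)}
    {g : C(Fin 2 → I, E)} (hg : ∀ u, p (g u) = f u)
    (hf : ∀ u ∈ Cube.boundary (Fin 2), ∀ v ∈ Cube.boundary (Fin 2), f u = f v) :
    ∀ u ∈ Cube.boundary (Fin 2), ∀ v ∈ Cube.boundary (Fin 2), g u = g v := by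
  intro u hu v hv
  exact cov.constOn_of_comp isPreconnected_boundary g.continuous.continuousOn
    (fun a ha b hb => by rw [hg, hg, hf a ha b hb]) hu hv

end Lifting

section Words

/-- Right multiplication by the involution `g` in the free product of copies of `ℤ/2`, on reduced
words (written in reverse order). -/
def flip (g : ℕ) : List ℕ → List ℕ
  | [] => [g]
  | h :: t => if h = g then t else g :: h :: t

theorem flip_cases (g : ℕ) (l : List ℕ) : flip g l = g :: l ∨ l = g :: flip g l := by
  cases l with
  | nil => exact Or.inl rfl
  | cons h t =>
    by_cases hg : h = g
    · right; simp [flip, hg]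
    · left; simp [flip, hg]

theorem isChain_flip (g : ℕ) {l : List ℕ} (hl : l.IsChain (· ≠ ·)) :
    (flip g l).IsChain (· ≠ ·) := by
  cases l with
  | nil => simp [flip]
  | cons h t =>
    by_cases hg : h = g
    · simpa [flip, hg] using hl.tail
    · simpa [flip, hg, List.isChain_cons_cons, Ne.symm hg] using hl

theorem flip_flip (g : ℕ) {l : List ℕ} (hl : l.IsChain (· ≠ ·)) : flip g (flip g l) = l := by
  cases l with
  | nil => simp [flip]
  | cons h t =>
    by_cases hg : h = g
    · subst hg
      cases t with
      | nil => simp [flip]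
      | cons a t =>
        have : h ≠ a := (List.isChain_cons_cons.1 hl).1
        simp [flip, Ne.symm this]
    · simp [flip, hg]

theorem even_length_flip (g : ℕ) (l : List ℕ) :
    Even (flip g l).length ↔ ¬ Even l.length := by
  rcases flip_cases g l with h | h
  · rw [h, List.length_cons, Nat.even_add_one]
  · conv_rhs => rw [h, List.length_cons, Nat.even_add_one, not_not]

/-- Reduced words in the free product of copies of `ℤ/2`, as a discrete space. -/
structure ReducedWord where
  /-- The letters of the word, in reverse order. -/
  letters : List ℕ
  isChain : letters.IsChain (· ≠ ·)

instance : TopologicalSpace ReducedWord := ⊥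

instance : DiscreteTopology ReducedWord := ⟨rfl⟩

/-- The action of a generator on reduced words. -/
def ReducedWord.flip (g : ℕ) (w : ReducedWord) : ReducedWord :=
  ⟨PuncturedTorus.flip g w.letters, isChain_flip g w.isChain⟩

@[simp]
theorem ReducedWord.flip_flip (g : ℕ) (w : ReducedWord) : (w.flip g).flip g = w := by
  cases w with
  | mk l hl => simp [ReducedWord.flip, PuncturedTorus.flip_flip g hl]

end Words

section Gates

variable (A : Finset ℝ)

/-- The plane with the points `(a, 0)`, `a ∈ A`, removed. -/
def slitPlane : Set (ℝ × ℝ) := {z | z.2 = 0 → z.1 ∉ A}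

/-- The index of the component of the complement of `A` containing `x`. -/
noncomputable def gate (x : ℝ) : ℕ := (A.filter (· < x)).card

theorem gate_mem_range (x : ℝ) : gate A x ∈ Finset.range (A.card + 1) :=
  Finset.mem_range.2 (Nat.lt_succ_of_le (Finset.card_filter_le _ _))

theorem eventually_gate_eq {x : ℝ} (hx : x ∉ A) : ∀ᶠ y in 𝓝 x, gate A y = gate A x := by
  have : ∀ᶠ y in 𝓝 x, ∀ a ∈ A, (a < y ↔ a < x) := by
    rw [Filter.eventually_all_finset]
    intro a ha
    rcases lt_or_gt_of_ne (fun h => hx (h ▸ ha) : a ≠ x) with h | h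
    · filter_upwards [lt_mem_nhds h] with y hy using iff_of_true hy h
    · filter_upwards [gt_mem_nhds h] with y hy using iff_of_false hy.not_gt h.not_gt
  filter_upwards [this] with y hy
  exact congrArg Finset.card (Finset.filter_congr hy)

variable {A} in
theorem not_mem_of_gate_eq {x y : ℝ} (hxy : gate A x = gate A y) {z : ℝ}
    (hxz : x ≤ z) (hzy : z < y) : z ∉ A := by
  intro hz
  refine hxy.not_lt (Finset.card_lt_card ?_)
  rw [Finset.ssubset_iff_of_subset]
  · refine ⟨z, by simp [hz, hzy], by simp [hxz.not_gt]⟩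
  · intro a
    simp only [Finset.mem_filter]
    exact fun h => ⟨h.1, h.2.trans_le (hxz.trans hzy.le)⟩

variable {A} in
theorem segment_not_mem {x y : ℝ} (hxy : gate A x = gate A y) (hx : x ∉ A) (hy : y ∉ A) (s : I) :
    (1 - (s : ℝ)) * x + s * y ∉ A := by
  have h0 := s.2.1
  have h1 := s.2.2
  rcases le_total x y with h | h
  · rcases (show (1 - (s : ℝ)) * x + s * y ≤ y by nlinarith).eq_or_lt with h' | h'
    · rwa [h']
    · exact not_mem_of_gate_eq hxy (by nlinarith) h'
  · rcases (show (1 - (s : ℝ)) * x + s * y ≤ x by nlinarith).eq_or_lt with h' | h'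
    · rwa [h']
    · exact not_mem_of_gate_eq hxy.symm (by nlinarith) h'

theorem exists_gate_points : ∃ m : ℕ → ℝ, (∀ g, m g ∉ A) ∧
    ∀ x ∉ A, ∀ s : I, (1 - (s : ℝ)) * x + s * m (gate A x) ∉ A := by
  obtain ⟨x₀, hx₀⟩ := Infinite.exists_notMem_finset A
  have : ∀ g : ℕ, ∃ y ∉ A, (∃ x ∉ A, gate A x = g) → gate A y = g := by
    intro g
    by_cases h : ∃ x ∉ A, gate A x = g
    · obtain ⟨x, hx, hg⟩ := h
      exact ⟨x, hx, fun _ => hg⟩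
    · exact ⟨x₀, hx₀, fun h' => (h h').elim⟩
  choose m hm hg using this
  exact ⟨m, hm, fun x hx s => segment_not_mem (hg _ ⟨x, hx, rfl⟩).symm hx (hm _) s⟩

/-- The covering space of the slit plane whose sheets over the upper half plane are indexed by
reduced words, crossing a gate acting by the corresponding letter. -/
noncomputable def gateCore : FiberBundleCore ℕ (slitPlane A) ReducedWord where
  baseSet g := {z | z.1.2 ≠ 0 ∨ gate A z.1.1 = g}
  isOpen_baseSet g := by
    rw [isOpen_iff_mem_nhds]
    intro z hz
    by_cases h : z.1.2 = 0
    · have h₁ : Filter.Tendsto (fun z : slitPlane A => z.1.1) (𝓝 z) (𝓝 z.1.1) :=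
        Continuous.tendsto (by fun_prop) z
      filter_upwards [h₁.eventually (eventually_gate_eq A (z.2 h))] with w hw
      exact Or.inr (hw.trans (hz.resolve_left (not_not.2 h)))
    · have h₂ : ContinuousAt (fun z : slitPlane A => z.1.2) z := by fun_prop
      filter_upwards [h₂.eventually_ne h] with w hw using Or.inl hw
  indexAt z := gate A z.1.1
  mem_baseSet_at z := Or.inr rfl
  coordChange i j z w := if z.1.2 < 0 then (w.flip i).flip j else w
  coordChange_self i z _ w := by simp
  coordChange_comp i j k z _ w := by split_ifs <;> simp
  continuousOn_coordChange i j := by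
    by_cases hij : i = j
    · subst hij
      simpa using continuous_snd.continuousOn
    · rintro ⟨z, w⟩ ⟨⟨h₁, h₂⟩, -⟩
      have hz : z.1.2 ≠ 0 := fun h =>
        hij ((h₁.resolve_left (not_not.2 h)).symm.trans (h₂.resolve_left (not_not.2 h)))
      have hc : ContinuousAt (fun p : slitPlane A × ReducedWord => p.1.1.2) (z, w) := by fun_prop
      refine ContinuousAt.continuousWithinAt ?_
      rcases hz.lt_or_gt with h | h
      · refine ContinuousAt.congr (f := fun p => (p.2.flip i).flip j) ?_ ?_
        · exact (continuous_of_discreteTopology (f := fun w : ReducedWord =>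
            (w.flip i).flip j)).continuousAt.comp continuous_snd.continuousAt
        · filter_upwards [hc.eventually_lt continuousAt_const h] with p hp
          simp [hp]
      · refine continuous_snd.continuousAt.congr ?_
        filter_upwards [continuousAt_const.eventually_lt hc h] with p hp
        simp [hp.not_gt]

theorem exists_word_lift (f : C(Fin 2 → I, ℝ × ℝ)) (hf : IsSphereIn (slitPlane A) f) :
    ∃ p : (Fin 2 → I) → List ℕ, p 0 = [] ∧ (∀ u, (p u).IsChain (· ≠ ·)) ∧
      (∀ u ∈ Cube.boundary (Fin 2), ∀ v ∈ Cube.boundary (Fin 2), p u = p v) ∧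
      ∀ u₀, ∀ᶠ u in 𝓝 u₀, (if (f u).2 < 0 then
        flip (gate A (f u₀).1) (flip (gate A (f u).1) (p u)) else p u) = p u₀ := by
  let Z := gateCore A
  have cov : IsCoveringMap (Bundle.TotalSpace.proj : Z.TotalSpace → slitPlane A) :=
    FiberBundle.isCoveringMap (F := ReducedWord) (E := Z.Fiber)
  let f' : C(Fin 2 → I, slitPlane A) := ⟨fun u => ⟨f u, hf.1 u⟩, by fun_prop⟩
  let e₀ : Z.TotalSpace := ⟨f' 0, (⟨[], List.isChain_nil⟩ : ReducedWord)⟩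
  obtain ⟨L, hL₀, hL⟩ := exists_lift_square cov f' e₀ rfl
  have hb := lift_const_boundary cov hL fun u hu v hv => Subtype.ext (hf.2 u hu v hv)
  let word : Z.TotalSpace → ReducedWord := fun e => e.2
  refine ⟨fun u => (word (L u)).letters, congrArg (fun e => (word e).letters) hL₀,
    fun u => (word (L u)).isChain,
    fun u hu v hv => congrArg (fun e => (word e).letters) (hb u hu v hv), fun u₀ => ?_⟩
  let g := gate A (f u₀).1
  have hsrc : L u₀ ∈ (Z.localTriv g).source := by
    rw [Z.mem_localTriv_source, hL]
    exact Z.mem_baseSet_at (f' u₀)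
  have hcont : ContinuousAt (fun u => (Z.localTriv g (L u)).2) u₀ :=
    continuous_snd.continuousAt.comp
      (((Z.localTriv g).continuousAt hsrc).comp L.continuous.continuousAt)
  have key : ∀ u, (Z.localTriv g (L u)).2 =
      if (f u).2 < 0 then ((word (L u)).flip (gate A (f u).1)).flip g else word (L u) := by
    intro u
    have h := hL u
    rw [Z.localTriv_apply]
    change (if (L u).proj.1.2 < 0 then
      ((word (L u)).flip (gate A (L u).proj.1.1)).flip g else word (L u)) = _
    rw [h]
    rfl
  have h₂ : ∀ᶠ u in 𝓝 u₀, (Z.localTriv g (L u)).2 = (Z.localTriv g (L u₀)).2 :=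
    hcont.eventually_mem (by rw [nhds_discrete]; exact Filter.mem_pure.2 rfl :
      {(Z.localTriv g (L u₀)).2} ∈ 𝓝 _)
  have h₃ : (Z.localTriv g (L u₀)).2 = word (L u₀) := by
    rw [key]
    simp [g]
  filter_upwards [h₂] with u hu
  rw [h₃, key] at hu
  rw [← hu]
  split_ifs <;> rfl

end Gates

section Branches

/-- The point at height `r` on the branch with address `l` of the tree covering a graph in the
plane, whose edges join `(0, 1)` to `(0, -1)` through the points `(m g, 0)`. -/
noncomputable def branch (m : ℕ → ℝ) : List ℕ → ℝ → ℝ × ℝ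
  | [], _ => (0, 1)
  | g :: t, r => branch m t r + ((1 - |1 - 2 * max 0 (min 1 (r - t.length))|) * m g,
      -2 * (-1) ^ t.length * max 0 (min 1 (r - t.length)))

variable (m : ℕ → ℝ)

theorem continuous_branch (l : List ℕ) : Continuous (branch m l) := by
  induction l with
  | nil => exact continuous_const
  | cons g t ih => simp only [branch]; fun_prop

theorem branch_of_length_le (l : List ℕ) {r : ℝ} (h : l.length ≤ r) :
    branch m l r = (0, (-1) ^ l.length) := by
  induction l with
  | nil => simp [branch]
  | cons g t ih =>
    rw [List.length_cons, Nat.cast_succ] at h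
    have hc : max 0 (min 1 (r - t.length)) = 1 := by
      rw [min_eq_left (by linarith), max_eq_right zero_le_one]
    rw [branch, ih (by linarith), hc, List.length_cons, pow_succ]
    ext
    · norm_num
    · simp only [Prod.snd_add]; ring

theorem branch_cons_of_le (g : ℕ) (t : List ℕ) {r : ℝ} (h : r ≤ t.length) :
    branch m (g :: t) r = branch m t r := by
  have hc : max 0 (min 1 (r - t.length)) = 0 :=
    max_eq_left ((min_le_right _ _).trans (by linarith))
  rw [branch, hc]
  simp

theorem branch_zero (l : List ℕ) : branch m l 0 = (0, 1) := by
  induction l with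
  | nil => rfl
  | cons g t ih => rw [branch_cons_of_le m g t (Nat.cast_nonneg _), ih]

theorem branch_cons_add (g : ℕ) (t : List ℕ) {c : ℝ} (h₀ : 0 ≤ c) (h₁ : c ≤ 1) :
    branch m (g :: t) (t.length + c) =
      ((1 - |1 - 2 * c|) * m g, (-1) ^ t.length * (1 - 2 * c)) := by
  have hc : max 0 (min 1 ((t.length : ℝ) + c - t.length)) = c := by
    rw [add_sub_cancel_left, min_eq_right h₁, max_eq_right h₀]
  rw [branch, hc, branch_of_length_le m t (by linarith)]
  ext
  · simp
  · simp only [Prod.snd_add]; ring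

theorem branch_mem_slitPlane {A : Finset ℝ} (hm : ∀ g, m g ∉ A) (l : List ℕ) (r : ℝ) :
    branch m l r ∈ slitPlane A := by
  induction l with
  | nil => intro h; simp [branch] at h
  | cons g t ih =>
    rcases le_total r t.length with h | h
    · rwa [branch_cons_of_le m g t h]
    · rcases le_total ((g :: t).length : ℝ) r with h' | h'
      · rw [branch_of_length_le m _ h']
        intro h0
        simp at h0
      · rw [List.length_cons, Nat.cast_succ] at h'
        obtain ⟨c, rfl⟩ : ∃ c, r = t.length + c := ⟨r - t.length, by ring⟩
        rw [branch_cons_add m g t (by linarith) (by linarith)]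
        intro h0
        have h1 : 1 - 2 * c = 0 := by simpa using h0
        simpa [h1] using hm g

/-- The point over a sheet joining the words `p` and `q`, scaled towards the root by `s`. -/
noncomputable def treePoint (p q : List ℕ) (α s : ℝ) : ℝ × ℝ :=
  branch m (if p.length < q.length then q else p) (s * (α * p.length + (1 - α) * q.length))

theorem treePoint_one (g : ℕ) (p : List ℕ) (s : I) :
    treePoint m p (flip g p) 1 s = branch m p (s * p.length) := by
  have hs : (s : ℝ) * p.length ≤ p.length := mul_le_of_le_one_left (Nat.cast_nonneg _) s.2.2
  unfold treePoint
  split_ifs with h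
  · rcases flip_cases g p with hp | hp
    · rw [hp] at h ⊢
      rw [show (1 * (p.length : ℝ) + (1 - 1) * ((g :: p).length : ℝ)) = p.length by ring,
        branch_cons_of_le m g p hs]
    · have := congrArg List.length hp
      rw [List.length_cons] at this
      omega
  · congr 1; ring

theorem treePoint_zero (g : ℕ) (q : List ℕ) (s : I) :
    treePoint m (flip g q) q 0 s = branch m q (s * q.length) := by
  have hs : (s : ℝ) * q.length ≤ q.length := mul_le_of_le_one_left (Nat.cast_nonneg _) s.2.2
  unfold treePoint
  split_ifs with h
  · congr 1; ring
  · rcases flip_cases g q with hq | hq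
    · rw [hq]
      rw [show (0 * ((g :: q).length : ℝ) + (1 - 0) * (q.length : ℝ)) = q.length by ring,
        branch_cons_of_le m g q hs]
    · have := congrArg List.length hq
      rw [List.length_cons] at this
      omega

theorem treePoint_flip (g : ℕ) (p : List ℕ) (hp : Even p.length) {α : ℝ} (h₀ : 0 ≤ α)
    (h₁ : α ≤ 1) :
    treePoint m p (flip g p) α 1 = ((1 - |2 * α - 1|) * m g, 2 * α - 1) := by
  unfold treePoint
  rcases flip_cases g p with h | h
  · rw [h, if_pos (by simp), List.length_cons, Nat.cast_succ,
      show 1 * (α * (p.length : ℝ) + (1 - α) * (p.length + 1)) = p.length + (1 - α) by ring,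
      branch_cons_add m g p (by linarith) (by linarith), hp.neg_one_pow]
    ring_nf
  · have hodd : Odd (flip g p).length := by
      rw [← Nat.not_even_iff_odd, even_length_flip, not_not]
      exact hp
    generalize flip g p = t at h hodd
    subst h
    rw [if_neg (by simp), List.length_cons, Nat.cast_succ,
      show 1 * (α * ((t.length : ℝ) + 1) + (1 - α) * t.length) = t.length + α by ring,
      branch_cons_add m g t h₀ h₁, hodd.neg_one_pow, abs_sub_comm]
    ring_nf

end Branches

section SlitPlane

theorem continuousAt_of_finite {ι X Y : Type*} [TopologicalSpace X] [TopologicalSpace Y]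
    (S : Finset ι) {F : ι → X → Y} {G : X → Y} {x₀ : X} (hF : ∀ i ∈ S, ContinuousAt (F i) x₀)
    (h₀ : ∀ i ∈ S, F i x₀ = G x₀) (hG : ∀ᶠ x in 𝓝 x₀, ∃ i ∈ S, G x = F i x) :
    ContinuousAt G x₀ := by
  intro O hO
  rw [Filter.mem_map]
  have : ∀ᶠ x in 𝓝 x₀, ∀ i ∈ S, F i x ∈ O := by
    rw [Filter.eventually_all_finset]
    intro i hi
    exact hF i hi (by rwa [h₀ i hi])
  filter_upwards [this, hG] with x hx ⟨i, hi, hGi⟩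
  exact mem_preimage.2 (hGi ▸ hx i hi)

theorem continuous_treePoint (A : Finset ℝ) (m : ℕ → ℝ) {f : C(Fin 2 → I, ℝ × ℝ)}
    (hf : IsSphereIn (slitPlane A) f) {p : (Fin 2 → I) → List ℕ}
    (hchain : ∀ u, (p u).IsChain (· ≠ ·))
    (hp : ∀ u₀, ∀ᶠ u in 𝓝 u₀, (if (f u).2 < 0 then
        flip (gate A (f u₀).1) (flip (gate A (f u).1) (p u)) else p u) = p u₀)
    {α : (Fin 2 → I) → ℝ} (hα : Continuous α)
    (hα₁ : ∀ u, (f u).1 ∈ A → 0 < (f u).2 → α u = 1)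
    (hα₀ : ∀ u, (f u).1 ∈ A → (f u).2 < 0 → α u = 0) :
    Continuous fun x : I × (Fin 2 → I) =>
      treePoint m (p x.2) (flip (gate A (f x.2).1) (p x.2)) (α x.2) x.1 := by
  have hc : ∀ P Q : List ℕ, Continuous fun x : I × (Fin 2 → I) =>
      treePoint m P Q (α x.2) x.1 := by
    intro P Q
    unfold treePoint
    exact (continuous_branch m _).comp (by fun_prop)
  rw [continuous_iff_continuousAt]
  rintro ⟨s, u₀⟩
  have hsnd : Filter.Tendsto (fun x : I × (Fin 2 → I) => x.2) (𝓝 (s, u₀)) (𝓝 u₀) :=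
    continuous_snd.continuousAt
  have hp' := hsnd.eventually (hp u₀)
  have hf₁ : Filter.Tendsto (fun x : I × (Fin 2 → I) => (f x.2).1) (𝓝 (s, u₀)) (𝓝 (f u₀).1) :=
    Continuous.tendsto (by fun_prop) (s, u₀)
  have hf₂ : Filter.Tendsto (fun x : I × (Fin 2 → I) => (f x.2).2) (𝓝 (s, u₀)) (𝓝 (f u₀).2) :=
    Continuous.tendsto (by fun_prop) (s, u₀)
  by_cases hA : (f u₀).1 ∈ A
  · rcases (show (f u₀).2 ≠ 0 from fun h => hf.1 u₀ h hA).lt_or_gt with hy | hy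
    · refine continuousAt_of_finite (Finset.range (A.card + 1))
        (F := fun g x => treePoint m (flip g (flip (gate A (f u₀).1) (p u₀)))
          (flip (gate A (f u₀).1) (p u₀)) (α x.2) x.1)
        (fun g _ => (hc _ _).continuousAt) (fun g _ => ?_) ?_
      · simp only [hα₀ u₀ hA hy]
        rw [treePoint_zero]
        have h := treePoint_zero m (gate A (f u₀).1) (flip (gate A (f u₀).1) (p u₀)) s
        rw [flip_flip _ (hchain u₀)] at h
        exact h.symm
      · filter_upwards [hp', hf₂.eventually_lt_const hy] with x hx hxy
        refine ⟨_, gate_mem_range A (f x.2).1, ?_⟩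
        rw [if_pos hxy] at hx
        have h := congrArg (flip (gate A (f u₀).1)) hx
        rw [flip_flip _ (isChain_flip _ (hchain _))] at h
        rw [← h, flip_flip _ (hchain _)]
    · refine continuousAt_of_finite (Finset.range (A.card + 1))
        (F := fun g x => treePoint m (p u₀) (flip g (p u₀)) (α x.2) x.1)
        (fun g _ => (hc _ _).continuousAt) (fun g _ => ?_) ?_
      · simp only [hα₁ u₀ hA hy]
        rw [treePoint_one, treePoint_one]
      · filter_upwards [hp', hf₂.eventually_const_lt hy] with x hx hxy
        refine ⟨_, gate_mem_range A (f x.2).1, ?_⟩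
        rw [if_neg hxy.not_gt] at hx
        rw [hx]
  · refine (hc (p u₀) (flip (gate A (f u₀).1) (p u₀))).continuousAt.congr ?_
    filter_upwards [hp', hf₁.eventually (eventually_gate_eq A hA)] with x hx hg
    rw [hg, flip_flip _ (hchain _), ite_self] at hx
    rw [hx, hg]

/-- The vertical position relative to the removed points, normalized to lie in `[-1, 1]`. -/
noncomputable def slope (A : Finset ℝ) (z : ℝ × ℝ) : ℝ :=
  z.2 / (|z.2| + |∏ a ∈ A, (z.1 - a)|)

variable {A : Finset ℝ}

theorem slope_denom_pos {z : ℝ × ℝ} (hz : z ∈ slitPlane A) :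
    0 < |z.2| + |∏ a ∈ A, (z.1 - a)| := by
  by_cases h : z.2 = 0
  · have : ∏ a ∈ A, (z.1 - a) ≠ 0 :=
      Finset.prod_ne_zero_iff.2 fun a ha h' => hz h (sub_eq_zero.1 h' ▸ ha)
    positivity
  · positivity

theorem abs_slope_le {z : ℝ × ℝ} (hz : z ∈ slitPlane A) : |slope A z| ≤ 1 := by
  rw [slope, abs_div, abs_of_pos (slope_denom_pos hz), div_le_one (slope_denom_pos hz)]
  exact le_add_of_nonneg_right (abs_nonneg _)

theorem slope_of_mem {z : ℝ × ℝ} (hz : z.1 ∈ A) : slope A z = z.2 / |z.2| := by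
  rw [slope, Finset.prod_eq_zero hz (sub_self _), abs_zero, add_zero]

theorem even_length_of_lift {f : C(Fin 2 → I, ℝ × ℝ)} {p : (Fin 2 → I) → List ℕ} (h₀ : p 0 = [])
    (hp : ∀ u₀, ∀ᶠ u in 𝓝 u₀, (if (f u).2 < 0 then
        flip (gate A (f u₀).1) (flip (gate A (f u).1) (p u)) else p u) = p u₀) (u : Fin 2 → I) :
    Even (p u).length := by
  have h : IsLocallyConstant fun u => Even (p u).length := by
    rw [IsLocallyConstant.iff_eventually_eq]
    intro u₀
    filter_upwards [hp u₀] with u hu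
    rw [← hu]
    split_ifs
    · rw [even_length_flip, even_length_flip, not_not]
    · rfl
  have := h.apply_eq_of_preconnectedSpace u 0
  simp only [h₀] at this
  simp [this]

theorem sphereNull_slitPlane (A : Finset ℝ) : SphereNull (slitPlane A) := by
  intro f hf
  obtain ⟨m, hm, hseg⟩ := exists_gate_points A
  obtain ⟨p, hp₀, hchain, hpb, hp⟩ := exists_word_lift A f hf
  have hslope : Continuous fun u => slope A (f u) := by
    unfold slope
    exact Continuous.div (by fun_prop) (by fun_prop) fun u => (slope_denom_pos (hf.1 u)).ne'
  have hle := fun u => abs_le.1 (abs_slope_le (hf.1 u))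
  have hH := continuous_treePoint A m hf hchain hp (α := fun u => (1 + slope A (f u)) / 2)
    (by fun_prop) (fun u hu hy => by rw [slope_of_mem hu, abs_of_pos hy, div_self hy.ne']; norm_num)
    (fun u hu hy => by
      rw [slope_of_mem hu, abs_of_neg hy, div_neg, div_self hy.ne]; norm_num)
  set H : I × (Fin 2 → I) → ℝ × ℝ := fun x => treePoint m (p x.2)
    (flip (gate A (f x.2).1) (p x.2)) ((1 + slope A (f x.2)) / 2) x.1 with hHdef
  have hH₁ : ∀ u, H (1, u) =
      ((1 - |slope A (f u)|) * m (gate A (f u).1), slope A (f u)) := by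
    intro u
    have := treePoint_flip m (gate A (f u).1) (p u) (even_length_of_lift hp₀ hp u)
      (α := (1 + slope A (f u)) / 2) (by linarith [hle u]) (by linarith [hle u])
    rw [show 2 * ((1 + slope A (f u)) / 2) - 1 = slope A (f u) by ring] at this
    exact this
  have hHb : ∀ t, ∀ u ∈ Cube.boundary (Fin 2), ∀ v ∈ Cube.boundary (Fin 2),
      H (t, u) = H (t, v) := by
    intro t u hu v hv
    simp only [hHdef]
    rw [hpb u hu v hv, hf.2 u hu v hv]
  let f₁ : C(Fin 2 → I, ℝ × ℝ) := ⟨fun u => H (1, u), by fun_prop⟩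
  refine ⟨(0, 1), ContinuousMap.HomotopicWith.trans (g := f₁) ?_ ?_⟩
  · refine homotopicWith_of_continuous
      (fun x => (1 - (x.1 : ℝ)) • f x.2 + (x.1 : ℝ) • H (1, x.2)) (by fun_prop)
      (fun u => by simp) (fun u => by simp [f₁]) fun t => ⟨fun u => ?_, fun u hu v hv => ?_⟩
    · intro h
      have ht₀ := t.2.1
      have ht₁ := t.2.2
      have hpos := slope_denom_pos (hf.1 u)
      simp only [ContinuousMap.coe_mk, hH₁, Prod.snd_add, Prod.smul_snd, smul_eq_mul] at h
      have hy : (f u).2 = 0 := by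
        have : (f u).2 * ((1 - (t : ℝ)) + t * (|(f u).2| + |∏ a ∈ A, ((f u).1 - a)|)⁻¹) = 0 := by
          rw [← h, slope]; ring
        refine (mul_eq_zero.1 this).resolve_right (ne_of_gt ?_)
        rcases ht₁.lt_or_eq with h' | h'
        · have := mul_nonneg ht₀ (inv_pos.2 hpos).le
          linarith
        · rw [h']
          simpa using hpos
      have hs : slope A (f u) = 0 := by rw [slope, hy, zero_div]
      simp only [ContinuousMap.coe_mk, hH₁, Prod.fst_add, Prod.smul_fst, smul_eq_mul, hs]
      simpa using hseg _ (hf.1 u hy) t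
    · simp only [ContinuousMap.coe_mk]
      rw [hf.2 u hu v hv, hHb 1 u hu v hv]
  · refine homotopicWith_of_continuous (fun x => H (σ x.1, x.2)) (by fun_prop)
      (fun u => by simp [f₁]) (fun u => ?_)
      fun t => ⟨fun u => branch_mem_slitPlane m hm _ _, fun u hu v hv => hHb _ u hu v hv⟩
    simp [hHdef, treePoint, branch_zero]

end SlitPlane

section Planar

theorem exists_injOn_shear (P : Finset (ℝ × ℝ)) :
    ∃ ε : ℝ, InjOn (fun z : ℝ × ℝ => z.1 + ε * z.2) P := by
  obtain ⟨ε, hε⟩ := Infinite.exists_notMem_finset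
    ((P ×ˢ P).image fun w => -(w.1.1 - w.2.1) / (w.1.2 - w.2.2))
  refine ⟨ε, fun z hz w hw h => ?_⟩
  simp only at h
  by_cases hzw : z.2 = w.2
  · ext
    · rw [hzw] at h; linarith
    · exact hzw
  · refine absurd (Finset.mem_image.2 ⟨(z, w), Finset.mem_product.2 ⟨hz, hw⟩, ?_⟩) hε
    have := sub_ne_zero.2 hzw
    field_simp
    linarith

/-- The homeomorphism of the plane that shears by `ε` and then straightens the graph of `q`. -/
noncomputable def straighten (ε : ℝ) (q : Polynomial ℝ) : ℝ × ℝ ≃ₜ ℝ × ℝ where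
  toFun z := (z.1 + ε * z.2, z.2 - q.eval (z.1 + ε * z.2))
  invFun w := (w.1 - ε * (w.2 + q.eval w.1), w.2 + q.eval w.1)
  left_inv z := by simp
  right_inv w := by simp
  continuous_toFun := by fun_prop
  continuous_invFun := by fun_prop

theorem sphereNull_compl_finset (P : Finset (ℝ × ℝ)) : SphereNull (P : Set (ℝ × ℝ))ᶜ := by
  obtain ⟨ε, hε⟩ := exists_injOn_shear P
  set v : ℝ × ℝ → ℝ := fun z => z.1 + ε * z.2 with hv
  set e := straighten ε (Lagrange.interpolate P v Prod.snd)
  have he : ∀ z ∈ P, e z = (v z, 0) := fun z hz =>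
    Prod.ext rfl (sub_eq_zero.2 (Lagrange.eval_interpolate_at_node Prod.snd hε hz).symm)
  refine SphereNull.preimage e ?_
  convert sphereNull_slitPlane (P.image v) using 1
  ext w
  simp only [mem_preimage, mem_compl_iff, Finset.mem_coe, slitPlane, mem_ofPred_eq,
    Finset.mem_image, not_exists, not_and]
  refine ⟨fun h h0 z hz hzw => h ?_, fun h hw => ?_⟩
  · rwa [show w = e z by rw [he z hz]; exact Prod.ext hzw.symm h0, e.symm_apply_apply]
  · have := he _ hw
    rw [e.apply_symm_apply] at this
    exact h (congrArg Prod.snd this) _ hw (congrArg Prod.fst this).symm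

end Planar

section Fiber

/-- The torus. -/
abbrev Torus := AddCircle (1 : ℝ) × AddCircle (1 : ℝ)

/-- The universal covering of the torus by the plane. -/
def proj (z : ℝ × ℝ) : Torus := ((z.1 : AddCircle (1 : ℝ)), (z.2 : AddCircle (1 : ℝ)))

theorem continuous_proj : Continuous proj :=
  ((AddCircle.continuous_mk' 1).comp continuous_fst).prodMk
    ((AddCircle.continuous_mk' 1).comp continuous_snd)

theorem finite_fiber_circle (d : AddCircle (1 : ℝ)) (R : ℝ) :
    {x : ℝ | (x : AddCircle (1 : ℝ)) = d ∧ |x| ≤ R}.Finite := by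
  obtain ⟨x₀, rfl⟩ := QuotientAddGroup.mk_surjective d
  refine ((Set.finite_Icc (-⌈R + |x₀|⌉) ⌈R + |x₀|⌉).image fun n : ℤ => x₀ + n).subset ?_
  rintro x ⟨hx, hR⟩
  obtain ⟨n, hn⟩ := (AddCircle.coe_eq_zero_iff (1 : ℝ)).1
    (show ((x - x₀ : ℝ) : AddCircle (1 : ℝ)) = 0 by rw [AddCircle.coe_sub]; exact sub_eq_zero.2 hx)
  rw [zsmul_one] at hn
  have hle : |(n : ℝ)| ≤ ⌈R + |x₀|⌉ := by
    rw [hn]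
    exact ((abs_sub _ _).trans (by gcongr)).trans (Int.le_ceil _)
  refine ⟨n, abs_le.1 (by exact_mod_cast hle), ?_⟩
  simp only [hn]
  ring

theorem finite_fiber {D : Set Torus} (hD : D.Finite) (R : ℝ) :
    {z : ℝ × ℝ | proj z ∈ D ∧ ‖z‖ ≤ R}.Finite := by
  refine (hD.biUnion fun d _ =>
    (finite_fiber_circle d.1 R).prod (finite_fiber_circle d.2 R)).subset ?_
  rintro z ⟨hz, hR⟩
  rw [Prod.norm_def, max_le_iff] at hR
  exact mem_biUnion hz ⟨⟨rfl, hR.1⟩, rfl, hR.2⟩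

theorem sphereNull_compl_fiber {D : Set Torus} (hD : D.Finite) :
    SphereNull (proj ⁻¹' D)ᶜ := by
  intro f hf
  obtain ⟨R₀, hR₀⟩ := (isCompact_range f.continuous).isBounded.exists_norm_le
  obtain ⟨R, hR, hRD⟩ := (Set.Ioo_infinite (lt_add_one (max R₀ 0))).exists_notMem_finite
    ((finite_fiber hD (max R₀ 0 + 1)).image norm)
  have hR0 : 0 < R := (le_max_right _ _).trans_lt hR.1
  set ψ : ℝ × ℝ → ℝ × ℝ := fun z => (max (-R) (min R z.1), max (-R) (min R z.2)) with hψ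
  have hclamp : ∀ x, |max (-R) (min R x)| ≤ R := fun x =>
    abs_le.2 ⟨le_max_left _ _, max_le (by linarith) (min_le_left _ _)⟩
  have hclamp' : ∀ x, |x| < R ∨ |max (-R) (min R x)| < R → max (-R) (min R x) = x := by
    intro x hx
    grind
  refine exists_homotopicWith_const_of_comp (U := (proj ⁻¹' D)ᶜ)
    (sphereNull_compl_finset (finite_fiber hD R).toFinset) (ψ := ψ) (by fun_prop)
    (fun z hz h => hz ?_) (g := f) ⟨fun u hu => hf.1 u ?_, hf.2⟩ fun u => ?_
  · have hle : ‖ψ z‖ ≤ R := max_le (hclamp _) (hclamp _)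
    have hlt : ‖ψ z‖ < R := hle.lt_of_ne fun h' =>
      hRD ⟨ψ z, ⟨h, hle.trans hR.2.le⟩, h'⟩
    have hz' : ψ z = z := Prod.ext (hclamp' _ (Or.inr ((le_max_left _ _).trans_lt hlt)))
      (hclamp' _ (Or.inr ((le_max_right _ _).trans_lt hlt)))
    rw [hz'] at h hle
    exact (Set.Finite.mem_toFinset _).2 ⟨h, hle⟩
  · exact ((Set.Finite.mem_toFinset _).1 hu).1
  · have h : ‖f u‖ < R := ((hR₀ _ (mem_range_self u)).trans (le_max_left _ _)).trans_lt hR.1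
    exact Prod.ext (hclamp' _ (Or.inl ((le_max_left _ _).trans_lt h)))
      (hclamp' _ (Or.inl ((le_max_right _ _).trans_lt h)))

end Fiber

section Push

variable {k : ℕ}

theorem proj_sub (x y : ℝ × ℝ) : proj (x - y) = proj x - proj y := rfl

theorem surjective_proj : Function.Surjective proj := fun d => by
  obtain ⟨x, hx⟩ := QuotientAddGroup.mk_surjective d.1
  obtain ⟨y, hy⟩ := QuotientAddGroup.mk_surjective d.2
  exact ⟨(x, y), Prod.ext hx hy⟩

theorem norm_proj_le (x : ℝ × ℝ) : ‖proj x‖ ≤ ‖x‖ :=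
  max_le_max QuotientAddGroup.norm_mk_le_norm QuotientAddGroup.norm_mk_le_norm

/-- The map of the plane moving the translates of each `a i` to those of `b i` and fixing all
points whose distance in the torus from all the `a i` is at least `r`. -/
noncomputable def push (r : ℝ) (a b : Fin k → ℝ × ℝ) (x : ℝ × ℝ) : ℝ × ℝ :=
  x + ∑ i, max 0 (1 - ‖proj x - proj (a i)‖ / r) • (b i - a i)

theorem continuous_push (r : ℝ) :
    Continuous fun p : (Fin k → ℝ × ℝ) × (Fin k → ℝ × ℝ) × (ℝ × ℝ) =>
      push r p.1 p.2.1 p.2.2 := by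
  have := continuous_proj
  unfold push
  fun_prop

theorem push_self (r : ℝ) (a : Fin k → ℝ × ℝ) (x : ℝ × ℝ) : push r a a x = x := by
  simp [push]

variable {r : ℝ} {a b : Fin k → ℝ × ℝ}

theorem push_of_le (hr : 0 < r) {x : ℝ × ℝ} (h : ∀ i, r ≤ ‖proj x - proj (a i)‖) :
    push r a b x = x := by
  refine add_eq_left.2 (Finset.sum_eq_zero fun i _ => ?_)
  rw [max_eq_left (sub_nonpos.2 ((one_le_div hr).2 (h i))), zero_smul]

theorem push_apply (hr : 0 < r) (h : ∀ i j, i ≠ j → r ≤ ‖proj (a i) - proj (a j)‖) (j : Fin k) :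
    push r a b (a j) = b j := by
  rw [push, Finset.sum_eq_single j]
  · simp
  · intro i _ hij
    rw [max_eq_left (sub_nonpos.2 ((one_le_div hr).2 (h j i hij.symm))), zero_smul]
  · simp

theorem proj_eq_of_proj_push_eq (hr : 0 < r) (hab : ∑ i, ‖b i - a i‖ < r)
    {x y : ℝ × ℝ} (h : proj (push r a b x) = proj (push r a b y)) : proj x = proj y := by
  by_contra hne
  obtain ⟨d, hd⟩ : ∃ d, d = ‖proj x - proj y‖ := ⟨_, rfl⟩
  have hpos : 0 < d := hd ▸ norm_pos_iff.2 (sub_ne_zero.2 hne)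
  have hlam : ∀ i, |max 0 (1 - ‖proj y - proj (a i)‖ / r) -
      max 0 (1 - ‖proj x - proj (a i)‖ / r)| ≤ d / r := by
    intro i
    rw [max_comm, max_comm (0 : ℝ)]
    refine (abs_max_sub_max_le_abs _ _ _).trans ?_
    rw [sub_sub_sub_cancel_left, ← sub_div, abs_div, abs_of_pos hr, hd,
      ← sub_sub_sub_cancel_right (proj x) (proj y) (proj (a i))]
    gcongr
    exact abs_norm_sub_norm_le _ _
  have hle : d ≤ ∑ i, d / r * ‖b i - a i‖ := by
    have heq : proj x - proj y = proj (∑ i, (max 0 (1 - ‖proj y - proj (a i)‖ / r) -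
        max 0 (1 - ‖proj x - proj (a i)‖ / r)) • (b i - a i)) := by
      rw [← proj_sub, ← sub_eq_zero, ← proj_sub]
      rw [← sub_eq_zero, ← proj_sub] at h
      rw [← h]
      congr 1
      simp only [push, sub_smul, Finset.sum_sub_distrib]
      abel
    refine (hd.trans (congrArg norm heq)).le.trans ?_
    refine (norm_proj_le _).trans ((norm_sum_le _ _).trans (Finset.sum_le_sum fun i _ => ?_))
    rw [norm_smul]
    exact mul_le_mul_of_nonneg_right (hlam i) (norm_nonneg _)
  rw [← Finset.mul_sum, div_mul_eq_mul_div, le_div_iff₀ hr] at hle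
  exact (lt_irrefl _) (hle.trans_lt (mul_lt_mul_of_pos_left hab hpos))

end Push

section Configurations

variable {S : Set Torus} {k : ℕ}

/-- Planar configurations whose points have distinct images in the torus, outside `S`. -/
def config (S : Set Torus) (k : ℕ) : Set (Fin k → ℝ × ℝ) :=
  {z | Function.Injective (fun i => proj (z i)) ∧ ∀ i, proj (z i) ∉ S}

theorem cons_mem_config {z : Fin k → ℝ × ℝ} {x : ℝ × ℝ} :
    (Fin.cons x z : Fin (k + 1) → ℝ × ℝ) ∈ config S (k + 1) ↔
      z ∈ config S k ∧ x ∈ (proj ⁻¹' (S ∪ range fun i => proj (z i)))ᶜ := by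
  have : (fun i => proj ((Fin.cons x z : Fin (k + 1) → ℝ × ℝ) i)) =
      Fin.cons (proj x) fun i => proj (z i) := by
    funext i
    refine Fin.cases ?_ (fun i => ?_) i <;> simp
  simp only [config, mem_ofPred_eq, this, Fin.cons_injective_iff, Fin.forall_fin_succ,
    Fin.cons_zero, Fin.cons_succ, mem_compl_iff, mem_preimage, mem_union]
  tauto

theorem push_mem {r : ℝ} (hr : 0 < r) {a b : Fin k → ℝ × ℝ}
    (hab : ∑ i, ‖b i - a i‖ < r) (ha : ∀ i j, i ≠ j → r ≤ ‖proj (a i) - proj (a j)‖)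
    (hS : ∀ s ∈ S, ∀ i, r ≤ ‖s - proj (a i)‖) {x : ℝ × ℝ}
    (hx : x ∈ (proj ⁻¹' (S ∪ range fun i => proj (a i)))ᶜ) :
    push r a b x ∈ (proj ⁻¹' (S ∪ range fun i => proj (b i)))ᶜ := by
  rintro (h | ⟨i, hi⟩)
  · obtain ⟨y, hy⟩ := surjective_proj (proj (push r a b x))
    rw [← hy] at h
    have hfix : push r a b y = y := push_of_le hr (hS _ h)
    refine hx (Or.inl ?_)
    rwa [proj_eq_of_proj_push_eq hr hab (y := y) (by rw [hfix, hy])]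
  · refine hx (Or.inr ⟨i, (proj_eq_of_proj_push_eq hr hab ?_).symm⟩)
    rw [push_apply hr ha]
    exact hi.symm

theorem exists_separation {K : Type*} [TopologicalSpace K] [CompactSpace K] (hS : S.Finite)
    {c : K → Fin k → ℝ × ℝ} (hc : Continuous c) (hcS : ∀ x, c x ∈ config S k) :
    ∃ r : ℝ, 0 < r ∧ ∀ x, (∀ i j, i ≠ j → r ≤ ‖proj (c x i) - proj (c x j)‖) ∧
      ∀ s ∈ S, ∀ i, r ≤ ‖s - proj (c x i)‖ := by
  have := continuous_proj
  have key : ∀ h : K → ℝ, Continuous h → (∀ x, 0 < h x) → ∀ᶠ r in 𝓝[>] (0 : ℝ), ∀ x, r ≤ h x := by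
    intro h hh hpos
    rcases isEmpty_or_nonempty K with hK | hK
    · exact Filter.Eventually.of_forall fun r x => hK.elim x
    · obtain ⟨x₀, -, hx₀⟩ := isCompact_univ.exists_isMinOn univ_nonempty hh.continuousOn
      filter_upwards [nhdsWithin_le_nhds (Iio_mem_nhds (hpos x₀))] with r hr x
      exact hr.le.trans (hx₀ (mem_univ x))
  have h₁ : ∀ᶠ r in 𝓝[>] (0 : ℝ), ∀ i j, i ≠ j → ∀ x, r ≤ ‖proj (c x i) - proj (c x j)‖ := by
    simp only [Filter.eventually_all]
    intro i j hij
    exact key _ (by fun_prop) fun x =>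
      norm_pos_iff.2 (sub_ne_zero.2 fun h => hij ((hcS x).1 h))
  have h₂ : ∀ᶠ r in 𝓝[>] (0 : ℝ), ∀ s ∈ S, ∀ i, ∀ x, r ≤ ‖s - proj (c x i)‖ := by
    rw [Filter.eventually_all_finite hS]
    intro s hs
    rw [Filter.eventually_all]
    intro i
    exact key _ (by fun_prop) fun x =>
      norm_pos_iff.2 (sub_ne_zero.2 fun h => (hcS x).2 i (h ▸ hs))
  obtain ⟨r, hr, hr₁, hr₂⟩ := ((eventually_mem_nhdsWithin (a := (0 : ℝ))).and (h₁.and h₂)).exists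
  exact ⟨r, hr, fun x => ⟨fun i j hij => hr₁ i j hij x, fun s hs i => hr₂ s hs i x⟩⟩

/-- The composite of the first `j` pushes following a homotopy `c` of configurations. -/
noncomputable def transport (r : ℝ) (t : ℕ → I) (c : I × (Fin 2 → I) → Fin k → ℝ × ℝ) :
    ℕ → I × (Fin 2 → I) → ℝ × ℝ → ℝ × ℝ
  | 0, _, z => z
  | j + 1, x, z => push r (c (min x.1 (t j), x.2)) (c (min x.1 (t (j + 1)), x.2))
      (transport r t c j x z)

theorem continuous_transport (r : ℝ) (t : ℕ → I) {c : I × (Fin 2 → I) → Fin k → ℝ × ℝ}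
    (hc : Continuous c) (j : ℕ) :
    Continuous fun p : (I × (Fin 2 → I)) × (ℝ × ℝ) => transport r t c j p.1 p.2 := by
  induction j with
  | zero => exact continuous_snd
  | succ j ih =>
    simp only [transport]
    exact (continuous_push r).comp (f := fun p : (I × (Fin 2 → I)) × (ℝ × ℝ) =>
      (c (min p.1.1 (t j), p.1.2), c (min p.1.1 (t (j + 1)), p.1.2), transport r t c j p.1 p.2))
      (by fun_prop)

theorem transport_zero (r : ℝ) (t : ℕ → I) (c : I × (Fin 2 → I) → Fin k → ℝ × ℝ) (j : ℕ)
    (u : Fin 2 → I) (z : ℝ × ℝ) : transport r t c j (0, u) z = z := by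
  induction j with
  | zero => rfl
  | succ j ih => simp [transport, ih, push_self]

theorem transport_congr (r : ℝ) (t : ℕ → I) {c : I × (Fin 2 → I) → Fin k → ℝ × ℝ} (j : ℕ)
    {u v : Fin 2 → I} (h : ∀ s, c (s, u) = c (s, v)) (s : I) (z : ℝ × ℝ) :
    transport r t c j (s, u) z = transport r t c j (s, v) z := by
  induction j with
  | zero => rfl
  | succ j ih => simp only [transport, ih, h]

/-- A lifting function for the projection forgetting one point of a configuration. -/
theorem exists_transport (hS : S.Finite) {c : I × (Fin 2 → I) → Fin k → ℝ × ℝ}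
    (hc : Continuous c) (hcS : ∀ x, c x ∈ config S k) :
    ∃ L : I × (Fin 2 → I) → ℝ × ℝ → ℝ × ℝ, (Continuous fun p : _ × _ => L p.1 p.2) ∧
      (∀ u z, L (0, u) z = z) ∧
      (∀ u v, (∀ s, c (s, u) = c (s, v)) → ∀ s z, L (s, u) z = L (s, v) z) ∧
      ∀ s u, ∀ z ∈ (proj ⁻¹' (S ∪ range fun i => proj (c (0, u) i)))ᶜ,
        L (s, u) z ∈ (proj ⁻¹' (S ∪ range fun i => proj (c (s, u) i)))ᶜ := by
  obtain ⟨r, hr, hrc⟩ := exists_separation hS hc hcS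
  obtain ⟨δ, hδ, hcδ⟩ := Metric.uniformContinuous_iff.1
    (CompactSpace.uniformContinuous_of_continuous hc) (r / (k + 1)) (by positivity)
  obtain ⟨n, hn⟩ := exists_nat_one_div_lt hδ
  let t : ℕ → I := fun j => projIcc 0 1 zero_le_one ((j : ℝ) / (n + 1))
  have ht₀ : t 0 = 0 := projIcc_of_le_left _ (by simp)
  have ht₁ : t (n + 1) = 1 :=
    projIcc_of_right_le _ (by rw [Nat.cast_succ, div_self (by positivity)])
  have ht : ∀ j s, dist (min s (t (j + 1))) (min s (t j)) < δ := by
    intro j s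
    refine lt_of_le_of_lt ?_ hn
    have hmin : dist (min s (t (j + 1))) (min s (t j)) ≤ dist (t (j + 1)) (t j) := by
      have hcoe : ∀ x : I, ((min s x : I) : ℝ) = min (s : ℝ) x := fun x =>
        Monotone.map_min (f := fun y : I => (y : ℝ)) fun _ _ h => h
      rw [Subtype.dist_eq, Subtype.dist_eq, Real.dist_eq, Real.dist_eq, hcoe, hcoe]
      simpa using abs_min_sub_min_le_max (s : ℝ) (t (j + 1)) s (t j)
    refine hmin.trans (((LipschitzWith.projIcc zero_le_one).dist_le_mul _ _).trans_eq ?_)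
    rw [Real.dist_eq, ← sub_div, Nat.cast_succ, add_sub_cancel_left, NNReal.coe_one, one_mul,
      abs_of_pos (by positivity)]
  have hstep : ∀ j s u, ∑ i, ‖c (min s (t (j + 1)), u) i - c (min s (t j), u) i‖ < r := by
    intro j s u
    have h := hcδ (a := (min s (t (j + 1)), u)) (b := (min s (t j), u))
      (by rw [Prod.dist_eq, dist_self]; exact max_lt (ht j s) hδ)
    have hsum : ∑ i, ‖c (min s (t (j + 1)), u) i - c (min s (t j), u) i‖ ≤
        ∑ _i : Fin k, r / (k + 1) := by
      refine Finset.sum_le_sum fun i _ => ?_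
      rw [← dist_eq_norm]
      exact (dist_le_pi_dist _ _ i).trans h.le
    refine hsum.trans_lt ?_
    rw [Finset.sum_const, Finset.card_univ, Fintype.card_fin, nsmul_eq_mul, ← mul_div_assoc,
      div_lt_iff₀ (by positivity)]
    linarith
  refine ⟨transport r t c (n + 1), continuous_transport r t hc _, transport_zero r t c _,
    fun u v h => transport_congr r t _ h, fun s u z hz => ?_⟩
  have hall : ∀ j, transport r t c j (s, u) z ∈
      (proj ⁻¹' (S ∪ range fun i => proj (c (min s (t j), u) i)))ᶜ := by
    intro j
    induction j with
    | zero => simpa [transport, ht₀] using hz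
    | succ j ih => exact push_mem hr (hstep j s u) (hrc _).1 (hrc _).2 ih
  have h := hall (n + 1)
  rwa [ht₁, min_eq_left le_one'] at h

theorem sphereNull_config (hS : S.Finite) (k : ℕ) : SphereNull (config S k) := by
  induction k with
  | zero =>
    intro f hf
    refine ⟨f 0, ?_⟩
    rw [show ContinuousMap.const _ (f 0) = f from
      ContinuousMap.ext fun u => Subsingleton.elim _ _]
    exact ContinuousMap.HomotopicWith.refl f hf
  | succ k ih =>
    intro f hf
    have hcons : ∀ u, Fin.cons (f u 0) (Fin.tail (f u)) = f u := fun u => Fin.cons_self_tail _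
    have hfS := fun u => cons_mem_config.1 ((hcons u).symm ▸ hf.1 u)
    obtain ⟨c, ⟨F⟩⟩ := ih ⟨fun u => Fin.tail (f u), continuous_pi fun i => by
        simp only [Fin.tail]; fun_prop⟩
      ⟨fun u => (hfS u).1, fun u hu v hv => congrArg Fin.tail (hf.2 u hu v hv)⟩
    have hF₀ : ∀ u, F (0, u) = Fin.tail (f u) := F.apply_zero
    have hF₁ : ∀ u, F (1, u) = c := F.apply_one
    obtain ⟨L, hLc, hL₀, hLcongr, hLmem⟩ := exists_transport hS F.continuous
      fun x => (F.prop x.1).1 x.2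
    have hLb : ∀ s, ∀ u ∈ Cube.boundary (Fin 2), ∀ v ∈ Cube.boundary (Fin 2),
        L (s, u) (f u 0) = L (s, v) (f v 0) := by
      intro s u hu v hv
      rw [hf.2 u hu v hv, hLcongr u v fun s => (F.prop s).2 u hu v hv]
    have hLf : Continuous fun x : I × (Fin 2 → I) => L x (f x.2 0) :=
      hLc.comp (f := fun x : I × (Fin 2 → I) => (x, f x.2 0)) (by fun_prop)
    have hmem : ∀ s u, L (s, u) (f u 0) ∈
        (proj ⁻¹' (S ∪ range fun i => proj (F (s, u) i)))ᶜ := fun s u =>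
      hLmem s u _ (by rw [hF₀]; exact (hfS u).2)
    let g : C(Fin 2 → I, ℝ × ℝ) := ⟨fun u => L (1, u) (f u 0), by fun_prop⟩
    have hg : ∀ u, g u ∈ (proj ⁻¹' (S ∪ range fun i => proj (c i)))ᶜ := fun u => by
      have h := hmem 1 u
      rwa [hF₁] at h
    have hcons_c : Continuous fun z : ℝ × ℝ => (Fin.cons z c : Fin (k + 1) → ℝ × ℝ) :=
      Continuous.finCons (A := fun _ => ℝ × ℝ) continuous_id continuous_const
    have hc : c ∈ config S k := hF₁ 0 ▸ (F.prop 1).1 0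
    obtain ⟨d, hd⟩ := exists_homotopicWith_const_of_comp
      (U := config S (k + 1)) (f := ⟨fun u => Fin.cons (g u) c, by fun_prop⟩)
      (sphereNull_compl_fiber (hS.union (finite_range fun i => proj (c i)))) hcons_c
      (fun z hz => cons_mem_config.2 ⟨hc, hz⟩) (g := g)
      ⟨hg, hLb 1⟩ fun u => rfl
    refine ⟨d, ContinuousMap.HomotopicWith.trans ?_ hd⟩
    refine homotopicWith_of_continuous
      (fun x => Fin.cons (L x (f x.2 0)) (F x)) (hLf.finCons F.continuous)
      (fun u => ?_) (fun u => ?_) fun s => ⟨fun u => ?_, fun u hu v hv => ?_⟩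
    · rw [hL₀, hF₀, hcons]
    · rw [hF₁]; rfl
    · exact cons_mem_config.2 ⟨(F.prop s).1 u, hmem s u⟩
    · have hF : F (s, u) = F (s, v) := (F.prop s).2 u hu v hv
      simp only [ContinuousMap.coe_mk, hLb s u hu v hv, hF]

/-- Configurations of points of the torus outside `S`. -/
def torusConfig (S : Set Torus) (k : ℕ) : Set (Fin k → Torus) :=
  {z | Function.Injective z ∧ ∀ i, z i ∉ S}

theorem sphereNull_torusConfig (hS : S.Finite) (k : ℕ) : SphereNull (torusConfig S k) := by
  intro f hf
  have hlift : ∀ h : C(Fin 2 → I, AddCircle (1 : ℝ)), ∃ g : C(Fin 2 → I, ℝ),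
      ∀ u, (g u : AddCircle (1 : ℝ)) = h u := fun h => by
    obtain ⟨e, he⟩ := QuotientAddGroup.mk_surjective (h 0)
    obtain ⟨g, -, hg⟩ := exists_lift_square (AddCircle.isCoveringMap_coe 1) h e he
    exact ⟨g, hg⟩
  choose g₁ hg₁ using fun i => hlift ⟨fun u => (f u i).1, by fun_prop⟩
  choose g₂ hg₂ using fun i => hlift ⟨fun u => (f u i).2, by fun_prop⟩
  let g : C(Fin 2 → I, Fin k → ℝ × ℝ) := ⟨fun u i => (g₁ i u, g₂ i u), by fun_prop⟩
  have hg : ∀ u, (fun i => proj (g u i)) = f u := fun u =>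
    funext fun i => Prod.ext (hg₁ i u) (hg₂ i u)
  have := continuous_proj
  refine exists_homotopicWith_const_of_comp (U := torusConfig S k) (sphereNull_config hS k)
    (ψ := fun z i => proj (z i)) (by fun_prop) (fun z hz => hz) (g := g)
    ⟨fun u => ?_, fun u hu v hv => funext fun i => Prod.ext ?_ ?_⟩ hg
  · have h := hf.1 u
    rw [← hg u] at h
    exact h
  · exact lift_const_boundary (AddCircle.isCoveringMap_coe 1) (hg₁ i)
      (fun a ha b hb => congrArg (fun w => (w i).1) (hf.2 a ha b hb)) u hu v hv
  · exact lift_const_boundary (AddCircle.isCoveringMap_coe 1) (hg₂ i)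
      (fun a ha b hb => congrArg (fun w => (w i).2) (hf.2 a ha b hb)) u hu v hv

end Configurations

end PuncturedTorus

theorem config_space_punctured_torus_pi2_trivial (m : ℕ) (hm : 1 ≤ m)
    (S : Set ((AddCircle (1 : ℝ)) × (AddCircle (1 : ℝ))))
    (hS : S.Finite) (hcard : hS.toFinset.card = m)
    (k : ℕ) (hk : 1 ≤ k)
    (y : {f : Fin k → ↥(Sᶜ) // Function.Injective f}) :
    Subsingleton
      (HomotopyGroup (Fin 2) {f : Fin k → ↥(Sᶜ) // Function.Injective f} y) := by
  have hι : IsEmbedding fun (z : {f : Fin k → ↥(Sᶜ) // Function.Injective f}) (i : Fin k) =>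
      ((z.1 i : ↥(Sᶜ)) : PuncturedTorus.Torus) :=
    (IsEmbedding.piMap fun _ => IsEmbedding.subtypeVal).comp IsEmbedding.subtypeVal
  refine PuncturedTorus.subsingleton_homotopyGroup hι ?_ y
  convert PuncturedTorus.sphereNull_torusConfig hS k using 1
  ext z
  refine ⟨?_, fun h => ?_⟩
  · rintro ⟨w, rfl⟩
    exact ⟨Subtype.val_injective.comp w.2, fun i => (w.1 i).2⟩
  · exact ⟨⟨fun i => ⟨z i, h.2 i⟩, fun i j hij => h.1 (congrArg Subtype.val hij)⟩, rfl⟩
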